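/- Assume n ≥ 2, x₁,…,xₙ > 0 not all equal, r₀ > −1, r∞ ∈ ℝ, k ∈ ℝ with n > max(2(r∞+1), k+1), and π_η : (0,∞) → (0,∞) continuous with π_η(η) ∝_{η→0⁺} η^{r₀} and π_η(η) ∝_{η→∞} η^{r∞}. Then s₃ := ∫₀^1 ∫₁^∞ h(β,η) dβ dη < ∞. -/

import Mathlib

open MeasureTheory Filter Set

/-- The modified Bessel function of the first kind of order 0:
`I₀(x) = ∑ (x/2)^(2m) / (m!)²`. -/
noncomputable def besselI0 (x : ℝ) : ℝ :=
  ∑' m : ℕ, (x / 2) ^ (2 * m) / ((Nat.factorial m : ℝ)) ^ 2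

/-- `I₀*(y) = e^(−y) I₀(y)`. -/
noncomputable def besselI0star (y : ℝ) : ℝ := Real.exp (-y) * besselI0 y

/-- `a(t) ∝ b(t)` along the filter `l`: the liminf of `a/b` is positive and the
limsup of `a/b` is finite (computed in `[0,∞]`). -/
def PropAt (a b : ℝ → ℝ) (l : Filter ℝ) : Prop :=
  0 < Filter.liminf (fun t => ENNReal.ofReal (a t / b t)) l ∧
    Filter.limsup (fun t => ENNReal.ofReal (a t / b t)) l < ⊤

/-- `h(β,η) = π_η(η)·β^(n−(k+3)/2)·η^((k+1)/2−n)·∏ᵢ I₀*(β xᵢ)·exp(−β ∑ᵢ (xᵢ−η)²/(2η))`. -/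
noncomputable def hFun (n : ℕ) (x : Fin n → ℝ) (k : ℝ) (πη : ℝ → ℝ) (β η : ℝ) : ℝ :=
  πη η * β ^ ((n : ℝ) - (k + 3) / 2) * η ^ ((k + 1) / 2 - (n : ℝ)) *
    (∏ i, besselI0star (β * x i)) *
    Real.exp (-(β * ∑ i, (x i - η) ^ 2 / (2 * η)))

theorem besselI0_nonneg (y : ℝ) : 0 ≤ besselI0 y :=
  tsum_nonneg fun m => by
    rw [pow_mul]
    positivity

theorem besselI0_le_cosh (y : ℝ) : besselI0 y ≤ Real.cosh y := by
  have hle : ∀ m : ℕ, (y / 2) ^ (2 * m) / (m.factorial : ℝ) ^ 2 ≤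
      y ^ (2 * m) / ((2 * m).factorial : ℝ) := by
    intro m
    have h1 : ((2 * m).factorial : ℝ) ≤ 2 ^ (2 * m) * (m.factorial : ℝ) ^ 2 := by
      have h2 := Nat.choose_mul_factorial_mul_factorial (n := 2 * m) (k := m) (by omega)
      have h3 : 2 * m - m = m := by omega
      rw [h3] at h2
      have h4 := Nat.choose_le_two_pow (2 * m) m
      have h5 : (2 * m).factorial ≤ 2 ^ (2 * m) * m.factorial ^ 2 := by
        rw [← h2, mul_assoc, ← sq]
        gcongr
      exact_mod_cast h5
    have hy : 0 ≤ y ^ (2 * m) := by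
      rw [pow_mul]
      positivity
    rw [div_pow, div_div]
    exact div_le_div_of_nonneg_left hy (by positivity) h1
  have hsum := Real.hasSum_cosh y
  have hnonneg : ∀ m : ℕ, 0 ≤ (y / 2) ^ (2 * m) / (m.factorial : ℝ) ^ 2 := fun m => by
    rw [pow_mul]
    positivity
  rw [← hsum.tsum_eq]
  exact (Summable.of_nonneg_of_le hnonneg hle hsum.summable).tsum_le_tsum hle hsum.summable

theorem besselI0star_nonneg (y : ℝ) : 0 ≤ besselI0star y :=
  mul_nonneg (Real.exp_pos _).le (besselI0_nonneg y)

theorem besselI0star_le_one {y : ℝ} (hy : 0 ≤ y) : besselI0star y ≤ 1 := by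
  have h1 : Real.cosh y ≤ Real.exp y := by
    rw [Real.cosh_eq]
    have := Real.exp_le_exp.2 (show -y ≤ y by linarith)
    linarith
  calc besselI0star y ≤ Real.exp (-y) * Real.exp y := by
        unfold besselI0star
        gcongr
        exact (besselI0_le_cosh y).trans h1
    _ = 1 := by rw [← Real.exp_add]; simp

/-- Data that are not all equal have squared deviations bounded below uniformly in the centre. -/
theorem exists_pos_le_sum_sub_sq {n : ℕ} (x : Fin n → ℝ) (hne : ∃ i j, x i ≠ x j) :
    ∃ S > 0, ∀ t : ℝ, S ≤ ∑ i, (x i - t) ^ 2 := by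
  obtain ⟨i, j, hij⟩ := hne
  refine ⟨(x i - x j) ^ 2 / 2, by have := sub_ne_zero.2 hij; positivity, fun t => ?_⟩
  have hne' : i ≠ j := fun h => hij (by rw [h])
  have h1 := Finset.sum_le_sum_of_subset_of_nonneg (Finset.subset_univ {i, j})
    (f := fun l => (x l - t) ^ 2) (fun l _ _ => sq_nonneg _)
  rw [Finset.sum_pair hne'] at h1
  nlinarith [sq_nonneg (x i - t + (x j - t))]

theorem PropAt.exists_eventually_le_mul {a b : ℝ → ℝ} {l : Filter ℝ} (h : PropAt a b l)
    (hb : ∀ᶠ t in l, 0 < b t) : ∃ M, ∀ᶠ t in l, a t ≤ M * b t := by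
  obtain ⟨M, hM, -⟩ := ENNReal.lt_iff_exists_nnreal_btwn.1 h.2
  refine ⟨M, ?_⟩
  filter_upwards [eventually_lt_of_limsup_lt hM, hb] with t ht hbt
  rw [← ENNReal.ofReal_coe_nnreal] at ht
  have h1 : a t / b t ≤ M := (ENNReal.ofReal_le_ofReal_iff M.2).1 ht.le
  exact (div_le_iff₀ hbt).1 h1

theorem tendsto_rpow_mul_exp_neg_div_nhdsGT_zero (s : ℝ) {c : ℝ} (hc : 0 < c) :
    Tendsto (fun t : ℝ => t ^ s * Real.exp (-(c / t))) (nhdsWithin 0 (Ioi 0)) (nhds 0) := by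
  have h := (tendsto_rpow_mul_exp_neg_mul_atTop_nhds_zero (-s) c hc).comp
    (tendsto_inv_nhdsGT_zero (𝕜 := ℝ))
  refine h.congr' ?_
  filter_upwards [self_mem_nhdsWithin] with t ht
  have ht : 0 < t := ht
  simp only [Function.comp_apply]
  rw [Real.inv_rpow ht.le, Real.rpow_neg ht.le, inv_inv, neg_mul, div_eq_mul_inv]

/-- A continuous weight of at most power growth at `0` stays bounded on `(0, 1)` after
multiplication by a power and by `exp (-c / t)`. -/
theorem exists_forall_mul_rpow_mul_exp_neg_div_le {f : ℝ → ℝ} (hf : ContinuousOn f (Ioi 0))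
    {r M₀ : ℝ} (hM₀ : ∀ᶠ t in nhdsWithin 0 (Ioi 0), f t ≤ M₀ * t ^ r) (s : ℝ)
    {c : ℝ} (hc : 0 < c) :
    ∃ M, ∀ t ∈ Ioo (0 : ℝ) 1, f t * t ^ s * Real.exp (-(c / t)) ≤ M := by
  have hlim : Tendsto (fun t : ℝ => M₀ * (t ^ (r + s) * Real.exp (-(c / t))))
      (nhdsWithin 0 (Ioi 0)) (nhds 0) := by
    simpa using (tendsto_rpow_mul_exp_neg_div_nhdsGT_zero (r + s) hc).const_mul M₀
  have hev : ∀ᶠ t in nhdsWithin 0 (Ioi (0 : ℝ)), f t * t ^ s * Real.exp (-(c / t)) ≤ 1 := by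
    filter_upwards [hM₀, hlim.eventually_le_const one_pos, self_mem_nhdsWithin] with t h1 h2 ht
    have ht : 0 < t := ht
    refine le_trans ?_ h2
    rw [Real.rpow_add ht]
    calc f t * t ^ s * Real.exp (-(c / t)) ≤ M₀ * t ^ r * t ^ s * Real.exp (-(c / t)) := by gcongr
      _ = _ := by ring
  obtain ⟨δ, hδ, hsub⟩ := mem_nhdsGT_iff_exists_Ioo_subset.1 hev
  have hδ : 0 < δ := hδ
  have hpos : ∀ t ∈ Icc δ 1, 0 < t := fun t ht => hδ.trans_le ht.1
  have hcont : ContinuousOn (fun t : ℝ => f t * t ^ s * Real.exp (-(c / t))) (Icc δ 1) := by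
    refine ((hf.mono fun t ht => hpos t ht).mul ?_).mul ?_
    · exact continuousOn_id.rpow_const fun t ht => Or.inl (hpos t ht).ne'
    · exact (continuousOn_const.div continuousOn_id fun t ht => (hpos t ht).ne').neg.rexp
  obtain ⟨B, hB⟩ := isCompact_Icc.bddAbove_image hcont
  refine ⟨max 1 B, fun t ht => ?_⟩
  rcases lt_or_ge t δ with h | h
  · exact le_max_of_le_left (hsub ⟨ht.1, h⟩)
  · exact le_max_of_le_right (hB ⟨t, ⟨h, ht.2.le⟩, rfl⟩)

theorem integrableOn_rpow_mul_exp_neg_mul_Ioi_one (p : ℝ) {c : ℝ} (hc : 0 < c) :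
    IntegrableOn (fun t : ℝ => t ^ p * Real.exp (-(c * t))) (Ioi 1) := by
  refine integrable_of_isBigO_exp_neg (b := c / 2) (by positivity) ?_ ?_
  · refine ContinuousOn.mul ?_ (by fun_prop)
    exact continuousOn_id.rpow_const fun t ht => Or.inl (zero_lt_one.trans_le ht).ne'
  · have h := (isLittleO_rpow_exp_pos_mul_atTop p (half_pos hc)).isBigO.mul
      (Asymptotics.isBigO_refl (fun t : ℝ => Real.exp (-(c * t))) atTop)
    refine h.congr_right fun t => ?_
    rw [← Real.exp_add]
    ring_nf

theorem stmt_13 (n : ℕ) (hn : 2 ≤ n) (x : Fin n → ℝ) (hx : ∀ i, 0 < x i)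
    (hne : ∃ i j, x i ≠ x j)
    (k r₀ rinf : ℝ) (hr₀ : r₀ > -1)
    (hnbig : (n : ℝ) > max (2 * (rinf + 1)) (k + 1))
    (πη : ℝ → ℝ) (hπη : ContinuousOn πη (Set.Ioi 0))
    (hπηpos : ∀ η : ℝ, 0 < η → 0 < πη η)
    (hprop0 : PropAt πη (fun η => η ^ r₀) (nhdsWithin 0 (Set.Ioi 0)))
    (hpropInf : PropAt πη (fun η => η ^ rinf) Filter.atTop) :
    (∫⁻ η in Set.Ioo (0 : ℝ) 1, ∫⁻ β in Set.Ioi (1 : ℝ),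
      ENNReal.ofReal (hFun n x k πη β η)) < ⊤ := by
  obtain ⟨S, hS, hSle⟩ := exists_pos_le_sum_sub_sq x hne
  obtain ⟨M₀, hM₀⟩ := hprop0.exists_eventually_le_mul <| by
    filter_upwards [self_mem_nhdsWithin] with t ht using Real.rpow_pos_of_pos ht _
  have hc : 0 < S / 4 := by positivity
  obtain ⟨M, hM⟩ := exists_forall_mul_rpow_mul_exp_neg_div_le hπη hM₀ ((k + 1) / 2 - n) hc
  set p : ℝ := (n : ℝ) - (k + 3) / 2
  have hbound : ∀ η ∈ Ioo (0 : ℝ) 1, ∀ β ∈ Ioi (1 : ℝ),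
      hFun n x k πη β η ≤ M * (β ^ p * Real.exp (-(S / 4 * β))) := by
    intro η hη β hβ
    have hη0 : 0 < η := hη.1
    have hβ1 : 1 < β := hβ
    have hβ0 : 0 < β := zero_lt_one.trans hβ1
    have hprod : ∏ i, besselI0star (β * x i) ≤ 1 :=
      Finset.prod_le_one (fun i _ => besselI0star_nonneg _)
        fun i _ => besselI0star_le_one (mul_pos hβ0 (hx i)).le
    have hexp : Real.exp (-(β * ∑ i, (x i - η) ^ 2 / (2 * η))) ≤
        Real.exp (-(S / 4 / η)) * Real.exp (-(S / 4 * β)) := by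
      rw [← Real.exp_add, Real.exp_le_exp, ← Finset.sum_div]
      have h1 : β * (S / (2 * η)) ≤ β * ((∑ i, (x i - η) ^ 2) / (2 * η)) := by
        gcongr
        exact hSle η
      have h2 : S / 4 / η + S / 4 * β ≤ β * (S / (2 * η)) := by
        have h3 : β * (S / (2 * η)) - (S / 4 / η + S / 4 * β) =
            S / 4 / η * ((β - 1) + β * (1 - η)) := by
          field_simp
          ring
        have h4 : 0 ≤ S / 4 / η * ((β - 1) + β * (1 - η)) := by
          have := sub_pos.2 hβ1
          have := sub_pos.2 hη.2
          positivity
        linarith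
      linarith
    have hπ := hπηpos η hη0
    calc hFun n x k πη β η
        ≤ πη η * β ^ p * η ^ ((k + 1) / 2 - (n : ℝ)) * 1 *
            (Real.exp (-(S / 4 / η)) * Real.exp (-(S / 4 * β))) := by
          unfold hFun
          gcongr
      _ = (πη η * η ^ ((k + 1) / 2 - (n : ℝ)) * Real.exp (-(S / 4 / η))) *
            (β ^ p * Real.exp (-(S / 4 * β))) := by ring
      _ ≤ _ := by
          gcongr
          exact hM η hη
  have hint : (∫⁻ β in Ioi (1 : ℝ), ENNReal.ofReal (M * (β ^ p * Real.exp (-(S / 4 * β))))) < ⊤ :=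
    ((integrableOn_rpow_mul_exp_neg_mul_Ioi_one p hc).const_mul M).lintegral_lt_top
  calc (∫⁻ η in Ioo (0 : ℝ) 1, ∫⁻ β in Ioi (1 : ℝ), ENNReal.ofReal (hFun n x k πη β η))
      ≤ ∫⁻ _ in Ioo (0 : ℝ) 1, ∫⁻ β in Ioi (1 : ℝ),
          ENNReal.ofReal (M * (β ^ p * Real.exp (-(S / 4 * β)))) :=
        setLIntegral_mono' measurableSet_Ioo fun η hη =>
          setLIntegral_mono' measurableSet_Ioi fun β hβ =>
            ENNReal.ofReal_le_ofReal (hbound η hη β hβ)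
    _ < ⊤ := by
        rw [setLIntegral_const]
        exact ENNReal.mul_lt_top hint (by simp)
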